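/- arXiv:1904.10305 — 7 statements merged into one kernel-verified Lean document; each statement's English description precedes it below -/
import Mathlib

section
/- Let K be a field of characteristic zero and let E be a nontrivial finite-dimensional Volterra evolution algebra over K (i.e. its structural matrix A relative to a natural basis is skew-symmetric and A ≠ 0). Then E is not nilpotent: there is no n ∈ ℕ with E^n = 0. -/
open Matrix

/-- The product in the evolution algebra (on `Fin n → K`) whose structural matrix,
relative to the natural basis of coordinate vectors, is `A`:
`e_i · e_j = 0` for `i ≠ j` and `e_i · e_i = ∑ k, A i k • e_k`. -/
def evolMul {K : Type} [Field K] {n : ℕ} (A : Matrix (Fin n) (Fin n) K)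
    (x y : Fin n → K) : Fin n → K :=
  fun k => ∑ i, x i * y i * A i k

/-- Product of two subspaces in the evolution algebra with structural matrix `A`. -/
def evolMulSub {K : Type} [Field K] {n : ℕ} (A : Matrix (Fin n) (Fin n) K)
    (M N : Submodule K (Fin n → K)) : Submodule K (Fin n → K) :=
  Submodule.span K {z | ∃ x ∈ M, ∃ y ∈ N, z = evolMul A x y}

/-- `algPow A k` is the subspace `E^{k+1}` of the evolution algebra `E` with structural
matrix `A`, where `E^1 = E` and `E^{k+1} = ∑_{i=1}^{k} E^i · E^{k+1-i}`. -/
def algPow {K : Type} [Field K] {n : ℕ} (A : Matrix (Fin n) (Fin n) K) :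
    ℕ → Submodule K (Fin n → K)
  | 0 => ⊤
  | (k+1) => ⨆ j : Fin (k+1), evolMulSub A (algPow A j) (algPow A (k - j))
  termination_by k => k
  decreasing_by
  · exact j.isLt
  · exact Nat.lt_succ_of_le (Nat.sub_le _ _)

theorem evolMul_mem_algPow_succ {K : Type} [Field K] {n : ℕ} (A : Matrix (Fin n) (Fin n) K)
    (x : Fin n → K) {y : Fin n → K} {k : ℕ} (hy : y ∈ algPow A k) :
    evolMul A x y ∈ algPow A (k + 1) := by
  rw [algPow]
  refine Submodule.mem_iSup_of_mem (0 : Fin (k + 1)) (Submodule.subset_span ⟨x, ?_, y, ?_, rfl⟩)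
  · simp [algPow]
  · simpa using hy

theorem evolMul_single_add_single_apply {K : Type} [Field K] {n : ℕ}
    (A : Matrix (Fin n) (Fin n) K) (i j : Fin n) (y : Fin n → K) (k : Fin n) :
    evolMul A (Pi.single i 1 + Pi.single j 1) y k = y i * A i k + y j * A j k := by
  simp [evolMul, Pi.single_apply, add_mul, Finset.sum_add_distrib]

/-- a nontrivial finite-dimensional Volterra evolution algebra (skew-symmetric
structural matrix `A ≠ 0`) over a field of characteristic zero is not nilpotent:
there is no `m` with `E^m = 0`. -/
theorem volterra_evolution_algebra_not_nilpotent
    {K : Type} [Field K] [CharZero K] {n : ℕ}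
    (A : Matrix (Fin n) (Fin n) K) (hskew : Aᵀ = -A) (hA : A ≠ 0) :
    ¬ ∃ m : ℕ, algPow A m = ⊥ := by
  have hdiag (i : Fin n) : A i i = 0 := self_eq_neg.mp (congrFun₂ hskew i i)
  obtain ⟨i, j, hij⟩ : ∃ i j, A i j ≠ 0 := by
    contrapose! hA
    ext i j
    exact hA i j
  have hji : A j i ≠ 0 := by
    have h : A j i = -A i j := congrFun₂ hskew i j
    rw [h]
    exact neg_ne_zero.mpr hij
  have key (m : ℕ) : ∃ y ∈ algPow A m, y i ≠ 0 ∨ y j ≠ 0 := by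
    induction m with
    | zero => exact ⟨1, by simp [algPow], by simp⟩
    | succ m ih =>
      obtain ⟨y, hy, hne⟩ := ih
      refine ⟨_, evolMul_mem_algPow_succ A (Pi.single i 1 + Pi.single j 1) hy, ?_⟩
      simpa [evolMul_single_add_single_apply, hdiag, hij, hji] using hne.symm
  rintro ⟨m, hm⟩
  obtain ⟨y, hy, hne⟩ := key m
  rw [hm, Submodule.mem_bot] at hy
  simp [hy] at hne
end

section
/- Let E be a finite-dimensional Volterra evolution algebra over a field of characteristic zero with natural basis {e_1, …, e_n} and skew-symmetric structural matrix A. If e_k·e_k ≠ 0 for some index k, then e_k ∉ ann^r(E) for every r ≥ 1; in particular, the upper annihilating series of a nontrivial Volterra evolution algebra never reaches E. -/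
open Matrix

/-- The upper annihilating series of the evolution algebra with structural matrix `A`:
`ann^0(E) = 0` and `x ∈ ann^{r+1}(E)` iff the class of `x` annihilates `E / ann^r(E)`,
i.e. `x·y ∈ ann^r(E)` and `y·x ∈ ann^r(E)` for all `y`. -/
def annSeries {K : Type} [Field K] {n : ℕ} (A : Matrix (Fin n) (Fin n) K) :
    ℕ → Set (Fin n → K)
  | 0 => {0}
  | (r+1) => {x | ∀ y, evolMul A x y ∈ annSeries A r ∧ evolMul A y x ∈ annSeries A r}

theorem evolMul_single {K : Type} [Field K] {n : ℕ} (A : Matrix (Fin n) (Fin n) K)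
    (x : Fin n → K) (j : Fin n) : evolMul A x (Pi.single j 1) = x j • A j := by
  ext m
  simp [evolMul, Pi.single_apply]

/-- For a skew-symmetric structural matrix, no nonzero multiple of a nonzero square `e_k · e_k`
lies in the upper annihilating series. -/
theorem smul_row_notMem_annSeries {K : Type} [Field K] {n : ℕ}
    (A : Matrix (Fin n) (Fin n) K) (hskew : Aᵀ = -A) (r : ℕ) (k : Fin n) (hk : A k ≠ 0)
    (c : K) (hc : c ≠ 0) : c • A k ∉ annSeries A r := by
  induction r generalizing k c with
  | zero => exact smul_ne_zero hc hk
  | succ r ih =>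
    intro h
    obtain ⟨j, hj⟩ := Function.ne_iff.mp hk
    have hkj : A k j = -A j k := congrFun (congrFun hskew j) k
    have hrow : A j ≠ 0 := fun h0 => hj (by simp [hkj, h0])
    have hmem := (h (Pi.single j 1)).1
    rw [evolMul_single] at hmem
    exact ih j hrow _ (mul_ne_zero hc hj) hmem

/-- in a finite-dimensional Volterra evolution algebra (skew-symmetric
structural matrix `A`) over a field of characteristic zero, if `e_k · e_k ≠ 0` then
`e_k ∉ ann^r(E)` for every `r ≥ 1`; in particular, if the algebra is nontrivial
(`A ≠ 0`) then the upper annihilating series never reaches `E`. -/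
theorem volterra_basis_vector_not_in_annihilating_series
    {K : Type} [Field K] [CharZero K] {n : ℕ}
    (A : Matrix (Fin n) (Fin n) K) (hskew : Aᵀ = -A) :
    (∀ k : Fin n, evolMul A (Pi.single k 1) (Pi.single k 1) ≠ 0 →
      ∀ r : ℕ, 1 ≤ r → Pi.single k 1 ∉ annSeries A r) ∧
    (A ≠ 0 → ∀ r : ℕ, annSeries A r ≠ Set.univ) := by
  have hrow : ∀ k, A k ≠ 0 → ∀ r, A k ∉ annSeries A r := fun k hk r => by
    simpa using smul_row_notMem_annSeries A hskew r k hk 1 one_ne_zero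
  refine ⟨fun k hk r hr hmem => ?_, fun hA r hr => ?_⟩
  · obtain ⟨s, rfl⟩ := Nat.exists_eq_add_of_le' hr
    have hsq := (hmem (Pi.single k 1)).1
    simp only [evolMul_single, Pi.single_eq_same, one_smul] at hk hsq
    exact hrow k hk s hsq
  · obtain ⟨k, hk⟩ := Function.ne_iff.mp hA
    exact hrow k hk r (hr ▸ Set.mem_univ _)
end

section
/- Let E_1 and E_2 be n-dimensional evolution algebras over a field K with natural bases {e_1, …, e_n} and {f_1, …, f_n} respectively, and suppose the structural matrix A of E_1 is nonsingular (rank A = n). If ψ : E_2 → E_1 is an algebra isomorphism and ψ(f_i) = Σ_j α_{ij} e_j, then α_{ik} α_{jk} = 0 for all i ≠ j and every k; consequently there exist a permutation σ of {1, …, n} and nonzero scalars λ_i ∈ K with ψ(f_i) = λ_i e_{σ(i)} for every i. -/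
open Matrix

theorem evolMul_eq_vecMul {K : Type} [Field K] {n : ℕ} (A : Matrix (Fin n) (Fin n) K)
    (x y : Fin n → K) : evolMul A x y = (x * y) ᵥ* A := rfl

theorem mul_eq_zero_of_evolMul_eq_zero {K : Type} [Field K] {n : ℕ}
    {A : Matrix (Fin n) (Fin n) K} (hA : A.det ≠ 0) {x y : Fin n → K}
    (h : evolMul A x y = 0) : x * y = 0 :=
  eq_zero_of_vecMul_eq_zero hA (evolMul_eq_vecMul A x y ▸ h)

theorem evolMul_single_of_ne {K : Type} [Field K] {n : ℕ} (B : Matrix (Fin n) (Fin n) K)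
    {i j : Fin n} (hij : i ≠ j) : evolMul B (Pi.single i 1) (Pi.single j 1) = 0 := by
  have h : (Pi.single i 1 : Fin n → K) * Pi.single j 1 = 0 := by
    ext k
    by_cases hk : k = i
    · subst hk
      simp [hij]
    · simp [hk]
  rw [evolMul_eq_vecMul, h, zero_vecMul]

/-- A family of `n` nonzero vectors in `Fin n → K` with pairwise disjoint supports consists of
nonzero multiples of the coordinate vectors, up to a permutation. -/
theorem exists_perm_eq_smul_single {K : Type} [Field K] {n : ℕ} (v : Fin n → Fin n → K)
    (hv : ∀ i, v i ≠ 0) (hdisj : ∀ i j k : Fin n, i ≠ j → v i k * v j k = 0) :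
    ∃ (σ : Equiv.Perm (Fin n)) (lam : Fin n → K),
      (∀ i, lam i ≠ 0) ∧ ∀ i : Fin n, v i = lam i • (Pi.single (σ i) 1 : Fin n → K) := by
  choose s hs using fun i => Function.ne_iff.mp (hv i)
  have hinj : Function.Injective s := by
    intro i j hij
    by_contra hne
    exact mul_ne_zero (hs i) (hij ▸ hs j) (hdisj i j (s i) hne)
  refine ⟨Equiv.ofBijective s (Finite.injective_iff_bijective.mp hinj), fun i => v i (s i), hs,
    fun i => ?_⟩
  ext l
  obtain ⟨j, rfl⟩ := Finite.surjective_of_injective hinj l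
  by_cases hij : i = j
  · subst hij
    simp
  · have h0 : v i (s j) = 0 := (mul_eq_zero.mp (hdisj i j (s j) hij)).resolve_right (hs j)
    simp [h0, hinj.ne (Ne.symm hij)]

/-- if `ψ : E₂ → E₁` is an isomorphism of `n`-dimensional evolution algebras
(with structural matrices `B` for `E₂` and `A` for `E₁`, both relative to the natural
bases of coordinate vectors), and `A` is nonsingular, then writing
`ψ(f_i) = ∑_j α_{ij} e_j` we have `α_{ik} α_{jk} = 0` for all `i ≠ j` and all `k`;
consequently there are a permutation `σ` and nonzero scalars `λ_i` with
`ψ(f_i) = λ_i e_{σ(i)}` for every `i`. -/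
theorem evolution_isomorphism_permutes_basis
    {K : Type} [Field K] {n : ℕ}
    (A B : Matrix (Fin n) (Fin n) K) (hA : A.det ≠ 0)
    (ψ : (Fin n → K) ≃ₗ[K] (Fin n → K))
    (hψ : ∀ x y : Fin n → K, ψ (evolMul B x y) = evolMul A (ψ x) (ψ y)) :
    (∀ i j k : Fin n, i ≠ j → ψ (Pi.single i 1) k * ψ (Pi.single j 1) k = 0) ∧
    ∃ (σ : Equiv.Perm (Fin n)) (lam : Fin n → K),
      (∀ i, lam i ≠ 0) ∧ ∀ i : Fin n, ψ (Pi.single i 1) = lam i • (Pi.single (σ i) 1 : Fin n → K) := by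
  have hdisj : ∀ i j k : Fin n, i ≠ j → ψ (Pi.single i 1) k * ψ (Pi.single j 1) k = 0 := by
    intro i j k hij
    refine congrFun (mul_eq_zero_of_evolMul_eq_zero hA ?_) k
    rw [← hψ, evolMul_single_of_ne B hij, map_zero]
  exact ⟨hdisj, exists_perm_eq_smul_single (fun i => ψ (Pi.single i 1)) (by simp) hdisj⟩
end

section
/- Let a, b, c ∈ [−1, 1] be nonzero real numbers all of the same sign, and let V : S^2 → S^2 be the Volterra quadratic stochastic operator V(x_1, x_2, x_3) = (x_1(1 + a x_2 − b x_3), x_2(1 − a x_1 + c x_3), x_3(1 + b x_1 − c x_2)). Then the ergodic theorem fails for V: there exists x ∈ S^2 for which the Cesàro averages (1/n) Σ_{k=0}^{n−1} V^k(x) do not converge as n → ∞. -/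
open Matrix Filter

/-- The Volterra quadratic stochastic operator associated with the skew-symmetric
matrix `A`: `(V_A x)_k = x_k (1 + ∑ i, a_{ki} x_i)`. -/
def volterraQSO {m : ℕ} (A : Matrix (Fin m) (Fin m) ℝ) (x : Fin m → ℝ) : Fin m → ℝ :=
  fun k => x k * (1 + ∑ i, A k i * x i)

/-- The Cesàro averages `(1/n) ∑_{k=0}^{n-1} V^k(x)` converge as `n → ∞`. -/
def CesaroConverges {m : ℕ} (V : (Fin m → ℝ) → (Fin m → ℝ)) (x : Fin m → ℝ) : Prop :=
  ∃ L : Fin m → ℝ,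
    Tendsto (fun N : ℕ => (N : ℝ)⁻¹ • ∑ k ∈ Finset.range N, V^[k] x) atTop (nhds L)

/-- Positive orbits on the two-dimensional simplex of the Volterra operator with parameters
`a`, `b`, `c` in `(0, 1]`, written coordinatewise. -/
structure VolterraOrbit (a b c : ℝ) (x y z : ℕ → ℝ) : Prop where
  a_pos : 0 < a
  b_pos : 0 < b
  c_pos : 0 < c
  a_le : a ≤ 1
  b_le : b ≤ 1
  c_le : c ≤ 1
  x_pos : ∀ n, 0 < x n
  y_pos : ∀ n, 0 < y n
  z_pos : ∀ n, 0 < z n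
  sum_eq : ∀ n, x n + y n + z n = 1
  x_succ : ∀ n, x (n + 1) = x n * (1 + (a * y n - b * z n))
  y_succ : ∀ n, y (n + 1) = y n * (1 + (c * z n - a * x n))
  z_succ : ∀ n, z (n + 1) = z n * (1 + (b * x n - c * y n))

/-- The limit of the averages of a real sequence. -/
def AverageTendsto (u : ℕ → ℝ) (l : ℝ) : Prop :=
  Tendsto (fun N : ℕ => (N : ℝ)⁻¹ * ∑ k ∈ Finset.range N, u k) atTop (nhds l)

theorem AverageTendsto.const_mul {u : ℕ → ℝ} {l : ℝ} (h : AverageTendsto u l) (r : ℝ) :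
    AverageTendsto (fun n => r * u n) (r * l) := by
  refine (Tendsto.const_mul r h).congr fun N => ?_
  rw [← Finset.mul_sum]; ring

theorem AverageTendsto.sub {u v : ℕ → ℝ} {l m : ℝ} (hu : AverageTendsto u l)
    (hv : AverageTendsto v m) : AverageTendsto (fun n => u n - v n) (l - m) := by
  refine (Tendsto.sub hu hv).congr fun N => ?_
  rw [Finset.sum_sub_distrib]; ring

theorem AverageTendsto.add {u v : ℕ → ℝ} {l m : ℝ} (hu : AverageTendsto u l)
    (hv : AverageTendsto v m) : AverageTendsto (fun n => u n + v n) (l + m) := by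
  refine (Tendsto.add hu hv).congr fun N => ?_
  rw [Finset.sum_add_distrib]; ring

theorem averageTendsto_const (r : ℝ) : AverageTendsto (fun _ => r) r := by
  refine tendsto_const_nhds.congr' ?_
  filter_upwards [eventually_gt_atTop 0] with N hN
  have : (N : ℝ) ≠ 0 := by positivity
  simp only [Finset.sum_const, Finset.card_range, nsmul_eq_mul]
  field_simp

theorem log_one_add_le_sub_sq {t : ℝ} (h₀ : -1 < t) (h₁ : t ≤ 1) :
    Real.log (1 + t) ≤ t - t ^ 2 / 4 := by
  rw [Real.log_le_iff_le_exp (by linarith)]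
  rcases le_total 0 t with ht | ht
  · have hu : 0 ≤ t - t ^ 2 / 4 := by nlinarith
    have hexp := Real.quadratic_le_exp_of_nonneg hu
    have : 0 ≤ t ^ 2 * ((1 - t / 4) ^ 2 - 1 / 2) :=
      mul_nonneg (sq_nonneg t) (by nlinarith)
    nlinarith
  · have hexp := Real.add_one_le_exp ((t - t ^ 2 / 4) / 2)
    have hnn : 0 ≤ (t - t ^ 2 / 4) / 2 + 1 := by nlinarith
    have hsq := mul_self_le_mul_self hnn hexp
    rw [← Real.exp_add, add_halves] at hsq
    have : 0 ≤ -t * t ^ 2 := mul_nonneg (by linarith) (sq_nonneg t)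
    nlinarith [sq_nonneg (t ^ 2)]

/-- A positive sequence whose logarithmic increments have negative average tends to zero. -/
theorem tendsto_zero_of_log_succ_le {x g : ℕ → ℝ} (hx : ∀ n, 0 < x n)
    (hg : ∀ n, Real.log (x (n + 1)) ≤ Real.log (x n) + g n) {δ : ℝ} (hδ : 0 < δ)
    (h : ∀ᶠ N : ℕ in atTop, (N : ℝ)⁻¹ * ∑ k ∈ Finset.range N, g k ≤ -δ) :
    Tendsto x atTop (nhds 0) := by
  have hsum : ∀ N, Real.log (x N) ≤ Real.log (x 0) + ∑ k ∈ Finset.range N, g k := by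
    intro N
    induction N with
    | zero => simp
    | succ N ih => rw [Finset.sum_range_succ]; linarith [hg N]
  have hlin : Tendsto (fun N : ℕ => Real.log (x 0) + -δ * (N : ℝ)) atTop atBot :=
    tendsto_atBot_add_const_left _ _
      (tendsto_natCast_atTop_atTop.const_mul_atTop_of_neg (by linarith))
  have hlog : Tendsto (fun N => Real.log (x N)) atTop atBot := by
    refine tendsto_atBot_mono' _ ?_ hlin
    filter_upwards [h, eventually_gt_atTop 0] with N hN hpos
    have hN' : (0 : ℝ) < N := by exact_mod_cast hpos
    rw [inv_mul_le_iff₀ hN'] at hN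
    linarith [hsum N]
  exact (Real.tendsto_exp_atBot.comp hlog).congr fun n => Real.exp_log (hx n)

namespace VolterraOrbit

variable {a b c : ℝ} {x y z : ℕ → ℝ}

/-- The cyclic symmetry of the system. -/
theorem rotate (h : VolterraOrbit a b c x y z) : VolterraOrbit c a b y z x where
  a_pos := h.c_pos
  b_pos := h.a_pos
  c_pos := h.b_pos
  a_le := h.c_le
  b_le := h.a_le
  c_le := h.b_le
  x_pos := h.y_pos
  y_pos := h.z_pos
  z_pos := h.x_pos
  sum_eq n := by linarith [h.sum_eq n]
  x_succ := h.y_succ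
  y_succ := h.z_succ
  z_succ := h.x_succ

theorem x_lt_one (h : VolterraOrbit a b c x y z) (n : ℕ) : x n < 1 := by
  linarith [h.sum_eq n, h.y_pos n, h.z_pos n]

theorem rate_mem (h : VolterraOrbit a b c x y z) (n : ℕ) :
    -1 < a * y n - b * z n ∧ a * y n - b * z n ≤ 1 := by
  have hy := h.rotate.x_lt_one n
  have hz := h.rotate.rotate.x_lt_one n
  have h₁ : a * y n ≤ 1 * y n := mul_le_mul_of_nonneg_right h.a_le (h.y_pos n).le
  have h₂ : b * z n ≤ 1 * z n := mul_le_mul_of_nonneg_right h.b_le (h.z_pos n).le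
  have h₃ := mul_pos h.a_pos (h.y_pos n)
  have h₄ := mul_pos h.b_pos (h.z_pos n)
  constructor <;> linarith

theorem log_x_succ_le (h : VolterraOrbit a b c x y z) (n : ℕ) :
    Real.log (x (n + 1)) ≤
      Real.log (x n) + ((a * y n - b * z n) - (a * y n - b * z n) ^ 2 / 4) := by
  obtain ⟨h₁, h₂⟩ := h.rate_mem n
  rw [h.x_succ, Real.log_mul (h.x_pos n).ne' (by linarith)]
  linarith [log_one_add_le_sub_sq h₁ h₂]

theorem not_tendsto_y_zero (h : VolterraOrbit a b c x y z) : ¬ Tendsto y atTop (nhds 0) := by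
  intro hy
  have hb := h.b_pos
  have hq : Tendsto (fun n => b / 2 - (b + a + c + b / 2 * a) * y n) atTop
      (nhds (b / 2 - (b + a + c + b / 2 * a) * 0)) :=
    tendsto_const_nhds.sub (hy.const_mul _)
  have hev : ∀ᶠ n in atTop, 0 < b / 2 - (b + a + c + b / 2 * a) * y n :=
    hq.eventually (lt_mem_nhds (by linarith))
  obtain ⟨N, hN⟩ := eventually_atTop.1 hev
  have hratio : ∀ n, N ≤ n → x (n + 1) / z (n + 1) ≤ (1 + b / 2)⁻¹ * (x n / z n) := by
    intro n hn
    have hz := h.z_pos n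
    have hx := h.x_pos n
    have hr := (h.rotate.rotate.rate_mem n).1
    have hkey : (1 + b / 2) * (1 + (a * y n - b * z n)) ≤ 1 + (b * x n - c * y n) := by
      have h₁ := hN n hn
      have h₂ : b * x n = b * (1 - y n - z n) := by rw [← h.sum_eq n]; ring
      rw [h₂]
      nlinarith [mul_pos (mul_pos hb hb) hz]
    rw [h.x_succ, h.z_succ, mul_div_mul_comm, mul_comm]
    refine mul_le_mul_of_nonneg_right ?_ (div_pos hx hz).le
    rw [div_le_iff₀ (by linarith), le_inv_mul_iff₀ (by linarith)]
    exact hkey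
  have hgeom : ∀ k, x (N + k) / z (N + k) ≤ (1 + b / 2)⁻¹ ^ k * (x N / z N) := by
    intro k
    induction k with
    | zero => simp
    | succ k ih =>
      calc x (N + (k + 1)) / z (N + (k + 1))
          ≤ (1 + b / 2)⁻¹ * (x (N + k) / z (N + k)) := hratio (N + k) (by omega)
        _ ≤ (1 + b / 2)⁻¹ * ((1 + b / 2)⁻¹ ^ k * (x N / z N)) :=
          mul_le_mul_of_nonneg_left ih (by positivity)
        _ = _ := by ring
  have hpow : Tendsto (fun k : ℕ => (1 + b / 2)⁻¹ ^ k * (x N / z N)) atTop (nhds 0) := by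
    have := (tendsto_pow_atTop_nhds_zero_of_lt_one (r := (1 + b / 2)⁻¹) (by positivity)
      (inv_lt_one_of_one_lt₀ (by linarith))).mul_const (x N / z N)
    simpa using this
  have hxs : Tendsto (fun k => x (N + k)) atTop (nhds 0) := by
    refine squeeze_zero (fun k => (h.x_pos _).le) (fun k => ?_) hpow
    refine le_trans ?_ (hgeom k)
    rw [le_div_iff₀ (h.z_pos _)]
    have := h.rotate.rotate.x_lt_one (N + k)
    nlinarith [h.x_pos (N + k)]
  have hx : Tendsto x atTop (nhds 0) := by
    rw [← tendsto_add_atTop_iff_nat N]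
    simpa [add_comm] using hxs
  have hrate : Tendsto (fun n => c * (1 - x n - y n) - a * x n) atTop
      (nhds (c * (1 - 0 - 0) - a * 0)) :=
    (((tendsto_const_nhds.sub hx).sub hy).const_mul c).sub (hx.const_mul a)
  have hrev : ∀ᶠ n in atTop, 0 < c * (1 - x n - y n) - a * x n :=
    hrate.eventually (lt_mem_nhds (by linarith [h.c_pos]))
  obtain ⟨M, hM⟩ := eventually_atTop.1 hrev
  have hmono : ∀ n, M ≤ n → y M ≤ y n := by
    intro n hn
    induction n, hn using Nat.le_induction with
    | base => exact le_rfl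
    | succ n hn ih =>
      refine ih.trans ?_
      have h₁ := hM n hn
      have h₂ : c * z n = c * (1 - x n - y n) := by rw [← h.sum_eq n]; ring
      rw [h.y_succ, h₂]
      nlinarith [mul_pos (h.y_pos n) h₁]
  have := ge_of_tendsto hy (eventually_atTop.2 ⟨M, hmono⟩)
  linarith [h.y_pos M]

theorem not_tendsto_x_zero (h : VolterraOrbit a b c x y z) : ¬ Tendsto x atTop (nhds 0) :=
  h.rotate.rotate.not_tendsto_y_zero

theorem log_sum_succ_le (h : VolterraOrbit a b c x y z) (n : ℕ) :
    c * Real.log (x (n + 1)) + b * Real.log (y (n + 1)) + a * Real.log (z (n + 1)) +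
        (c * (a * y n - b * z n) ^ 2 + b * (c * z n - a * x n) ^ 2 +
          a * (b * x n - c * y n) ^ 2) / 4 ≤
      c * Real.log (x n) + b * Real.log (y n) + a * Real.log (z n) := by
  have h₁ := mul_le_mul_of_nonneg_left (h.log_x_succ_le n) h.c_pos.le
  have h₂ := mul_le_mul_of_nonneg_left (h.rotate.log_x_succ_le n) h.b_pos.le
  have h₃ := mul_le_mul_of_nonneg_left (h.rotate.rotate.log_x_succ_le n) h.a_pos.le
  linarith

/-- Orbits starting below the maximum of the Lyapunov function approach the boundary. -/
theorem tendsto_mul_zero (h : VolterraOrbit a b c x y z)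
    (h₀ : c * Real.log (x 0) + b * Real.log (y 0) + a * Real.log (z 0) <
      c * Real.log (c / (a + b + c)) + b * Real.log (b / (a + b + c)) +
        a * Real.log (a / (a + b + c))) :
    Tendsto (fun n => x n * y n * z n) atTop (nhds 0) := by
  have ha := h.a_pos
  have hb := h.b_pos
  have hc := h.c_pos
  set Φ : ℕ → ℝ := fun n => c * Real.log (x n) + b * Real.log (y n) + a * Real.log (z n) with hΦ
  have hstep : ∀ n, Φ (n + 1) + (c * (a * y n - b * z n) ^ 2 + b * (c * z n - a * x n) ^ 2 +
          a * (b * x n - c * y n) ^ 2) / 4 ≤ Φ n := h.log_sum_succ_le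
  have hanti : Antitone Φ := antitone_nat_of_succ_le fun n => by
    have : 0 ≤ (c * (a * y n - b * z n) ^ 2 + b * (c * z n - a * x n) ^ 2 +
          a * (b * x n - c * y n) ^ 2) / 4 := by positivity
    linarith [hstep n]
  rcases tendsto_atTop_of_antitone hanti with hbot | ⟨l, hl⟩
  · have hlog : Tendsto (fun n => Real.log (x n * y n * z n)) atTop atBot := by
      refine tendsto_atBot_mono (fun n => ?_) hbot
      have hx := h.x_pos n
      have hy := h.y_pos n
      have hz := h.z_pos n
      rw [Real.log_mul (by positivity) hz.ne', Real.log_mul hx.ne' hy.ne']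
      have h₁ := Real.log_nonpos hx.le (h.x_lt_one n).le
      have h₂ := Real.log_nonpos hy.le (h.rotate.x_lt_one n).le
      have h₃ := Real.log_nonpos hz.le (h.rotate.rotate.x_lt_one n).le
      have := h.a_le
      have := h.b_le
      have := h.c_le
      simp only [hΦ]
      nlinarith
    refine (Real.tendsto_exp_atBot.comp hlog).congr fun n => Real.exp_log ?_
    exact mul_pos (mul_pos (h.x_pos n) (h.y_pos n)) (h.z_pos n)
  · exfalso
    have hdiff : Tendsto (fun n => Φ n - Φ (n + 1)) atTop (nhds 0) := by
      simpa using hl.sub (hl.comp (tendsto_add_atTop_nat 1))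
    have hzero : ∀ {r : ℝ} {f : ℕ → ℝ}, 0 < r → (∀ n, r * f n ^ 2 / 4 ≤ Φ n - Φ (n + 1)) →
        Tendsto f atTop (nhds 0) := by
      intro r f hr hf
      have hsq : Tendsto (fun n => f n ^ 2) atTop (nhds 0) := by
        refine squeeze_zero (fun n => sq_nonneg _) (fun n => ?_)
          (by simpa using hdiff.const_mul (4 / r))
        have := hf n
        rw [div_mul_eq_mul_div, le_div_iff₀ hr]
        linarith
      have habs := hsq.sqrt
      simp only [Real.sqrt_sq_eq_abs, Real.sqrt_zero] at habs
      exact (tendsto_zero_iff_abs_tendsto_zero f).2 habs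
    have hf : Tendsto (fun n => a * y n - b * z n) atTop (nhds 0) := hzero hc fun n => by
      have : 0 ≤ b * (c * z n - a * x n) ^ 2 + a * (b * x n - c * y n) ^ 2 := by positivity
      linarith [hstep n]
    have hg : Tendsto (fun n => c * z n - a * x n) atTop (nhds 0) := hzero hb fun n => by
      have : 0 ≤ c * (a * y n - b * z n) ^ 2 + a * (b * x n - c * y n) ^ 2 := by positivity
      linarith [hstep n]
    have hz : Tendsto z atTop (nhds (a / (a + b + c))) := by
      have := ((tendsto_const_nhds (x := a)).sub hf).add hg |>.div_const (a + b + c)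
      simp only [sub_zero, add_zero] at this
      refine this.congr fun n => ?_
      rw [div_eq_iff (by positivity)]
      linear_combination (-a) * h.sum_eq n
    have hy : Tendsto y atTop (nhds (b / (a + b + c))) := by
      have := (hf.add (hz.const_mul b)).div_const a
      have he : (0 + b * (a / (a + b + c))) / a = b / (a + b + c) := by field_simp; ring
      rw [he] at this
      refine this.congr fun n => ?_
      field_simp
      ring
    have hx : Tendsto x atTop (nhds (c / (a + b + c))) := by
      have := ((hz.const_mul c).sub hg).div_const a
      have he : (c * (a / (a + b + c)) - 0) / a = c / (a + b + c) := by field_simp; ring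
      rw [he] at this
      refine this.congr fun n => ?_
      field_simp
      ring
    have hlim : Tendsto Φ atTop (nhds (c * Real.log (c / (a + b + c)) +
        b * Real.log (b / (a + b + c)) + a * Real.log (a / (a + b + c)))) :=
      (((hx.log (by positivity)).const_mul c).add ((hy.log (by positivity)).const_mul b)).add
        ((hz.log (by positivity)).const_mul a)
    have := le_of_tendsto hlim (Eventually.of_forall fun n => hanti (Nat.zero_le n))
    simp only [hΦ] at this
    linarith

theorem averages_nonneg (h : VolterraOrbit a b c x y z) {Y Z : ℝ}
    (hY : AverageTendsto y Y) (hZ : AverageTendsto z Z) : 0 ≤ a * Y - b * Z := by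
  by_contra! hneg
  refine h.not_tendsto_x_zero (tendsto_zero_of_log_succ_le h.x_pos
    (g := fun n => a * y n - b * z n) (fun n => ?_) (δ := -(a * Y - b * Z) / 2) (by linarith) ?_)
  · have := h.log_x_succ_le n
    nlinarith [sq_nonneg (a * y n - b * z n)]
  · exact Tendsto.eventually_le_const (by linarith) ((hY.const_mul a).sub (hZ.const_mul b))

/-- Close to the boundary the growth rate of `x` vanishes at two consecutive times only where
`y` is small. -/
theorem y_cube_le (h : VolterraOrbit a b c x y z) (n : ℕ) :
    a * c * (a + b) * y n ^ 3 ≤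
      4 * (|a * y n - b * z n| + |a * y (n + 1) - b * z (n + 1)| + x n * y n * z n) := by
  have ha := h.a_pos
  have hb := h.b_pos
  have hc := h.c_pos
  have hx := h.x_pos n
  have hy := h.y_pos n
  have hz := h.z_pos n
  have hx1 := (h.x_lt_one n).le
  have hy1 := (h.rotate.x_lt_one n).le
  have ha1 := h.a_le
  have hb1 := h.b_le
  have hc1 := h.c_le
  set f := a * y n - b * z n with hf
  set f' := a * y (n + 1) - b * z (n + 1) with hf'
  have hid : a * c * (a + b) * y n ^ 3 = b * y n * f' +
      (a * b * (x n * y n) + c * (a + b) * y n ^ 2 - b * y n) * f +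
        b ^ 2 * (a + b) * (x n * y n * z n) := by
    rw [hf', hf, h.y_succ, h.z_succ]; ring
  have hby : b * y n ≤ 1 := mul_le_one₀ hb1 hy.le hy1
  have hab : a * b ≤ 1 := mul_le_one₀ ha1 hb.le hb1
  have hxy : x n * y n ≤ 1 := mul_le_one₀ hx1 hy.le hy1
  have habxy : a * b * (x n * y n) ≤ 1 := mul_le_one₀ hab (by positivity) hxy
  have hcab : c * (a + b) ≤ 2 := by nlinarith
  have hy2 : y n ^ 2 ≤ 1 := pow_le_one₀ hy.le hy1
  have hcaby : c * (a + b) * y n ^ 2 ≤ 2 := by nlinarith [mul_pos hc (add_pos ha hb)]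
  have hb2 : b ^ 2 ≤ 1 := pow_le_one₀ hb.le hb1
  have hbab : b ^ 2 * (a + b) ≤ 4 := by nlinarith
  have e₁ : b * y n * f' ≤ 4 * |f'| := by
    calc b * y n * f' ≤ b * y n * |f'| := mul_le_mul_of_nonneg_left (le_abs_self _) (by positivity)
      _ ≤ 4 * |f'| := mul_le_mul_of_nonneg_right (by linarith) (abs_nonneg _)
  have e₂ : (a * b * (x n * y n) + c * (a + b) * y n ^ 2 - b * y n) * f ≤ 4 * |f| := by
    refine (le_abs_self _).trans ?_
    rw [abs_mul]
    refine mul_le_mul_of_nonneg_right ?_ (abs_nonneg _)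
    have : 0 < a * b * (x n * y n) := by positivity
    have : 0 < c * (a + b) * y n ^ 2 := by positivity
    have : 0 < b * y n := by positivity
    rw [abs_le]
    constructor <;> linarith
  have e₃ : b ^ 2 * (a + b) * (x n * y n * z n) ≤ 4 * (x n * y n * z n) :=
    mul_le_mul_of_nonneg_right hbab (by positivity)
  linarith

theorem not_averageTendsto (h : VolterraOrbit a b c x y z)
    (h₀ : c * Real.log (x 0) + b * Real.log (y 0) + a * Real.log (z 0) <
      c * Real.log (c / (a + b + c)) + b * Real.log (b / (a + b + c)) +
        a * Real.log (a / (a + b + c))) {X Y Z : ℝ}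
    (hX : AverageTendsto x X) (hY : AverageTendsto y Y) (hZ : AverageTendsto z Z) : False := by
  have ha := h.a_pos
  have hb := h.b_pos
  have hc := h.c_pos
  have h₁ := h.averages_nonneg hY hZ
  have h₂ := h.rotate.averages_nonneg hZ hX
  have h₃ := h.rotate.rotate.averages_nonneg hX hY
  have hsum : X + Y + Z = 1 := by
    refine tendsto_nhds_unique ((hX.add hY).add hZ) ?_
    simp only [h.sum_eq]
    exact averageTendsto_const 1
  have hf₀ : a * Y - b * Z = 0 := by
    refine le_antisymm ?_ h₁
    by_contra! hpos
    nlinarith [mul_pos hc hpos, mul_nonneg hb.le h₂, mul_nonneg ha.le h₃]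
  have hg₀ : c * Z - a * X = 0 := by
    refine le_antisymm ?_ h₂
    by_contra! hpos
    nlinarith [mul_pos hb hpos, mul_nonneg hc.le h₁, mul_nonneg ha.le h₃]
  have hZpos : 0 < Z := by
    have : (a + b + c) * Z = a := by linear_combination a * hsum - hf₀ + hg₀
    by_contra! hneg
    nlinarith [mul_nonneg (add_pos (add_pos ha hb) hc).le (neg_nonneg.2 hneg)]
  have hYpos : 0 < Y := by
    by_contra! hneg
    nlinarith [mul_pos hb hZpos]
  have hw : AverageTendsto (fun n => x n * y n * z n) 0 := (h.tendsto_mul_zero h₀).cesaro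
  set f : ℕ → ℝ := fun n => a * y n - b * z n with hf
  have hfavg : AverageTendsto f 0 := by
    rw [← hf₀]; exact (hY.const_mul a).sub (hZ.const_mul b)
  set κ := a * c * (a + b) with hκ
  have hκpos : 0 < κ := by positivity
  set ε := κ * Y ^ 3 / 16 with hε
  have hεpos : 0 < ε := by positivity
  have habs : ∀ t : ℝ, |t| ≤ ε + t ^ 2 / (4 * ε) := by
    intro t
    have h4 : 0 < 4 * ε := by positivity
    rw [← sub_le_iff_le_add', le_div_iff₀ h4, ← sq_abs t]
    nlinarith [sq_nonneg (|t| - 2 * ε)]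
  have hpt : ∀ n, ε * (κ * (3 * Y ^ 2 * y n - 2 * Y ^ 3) - 8 * ε - 4 * (x n * y n * z n)) ≤
      f n ^ 2 + f (n + 1) ^ 2 := by
    intro n
    have hcube : 3 * Y ^ 2 * y n - 2 * Y ^ 3 ≤ y n ^ 3 := by
      have := h.y_pos n
      nlinarith [mul_nonneg (sq_nonneg (y n - Y)) (by linarith : 0 ≤ y n + 2 * Y)]
    have e₁ := h.y_cube_le n
    have e₂ := mul_le_mul_of_nonneg_left hcube hκpos.le
    have e₃ := habs (f n)
    have e₄ := habs (f (n + 1))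
    have e₅ : κ * (3 * Y ^ 2 * y n - 2 * Y ^ 3) - 8 * ε - 4 * (x n * y n * z n) ≤
        (f n ^ 2 + f (n + 1) ^ 2) / ε := by
      have : (f n ^ 2 + f (n + 1) ^ 2) / ε =
          4 * (f n ^ 2 / (4 * ε) + f (n + 1) ^ 2 / (4 * ε)) := by field_simp
      rw [this]
      linarith
    rw [le_div_iff₀ hεpos] at e₅
    linarith
  have hlow : AverageTendsto
      (fun n => ε * (κ * (3 * Y ^ 2 * y n - 2 * Y ^ 3) - 8 * ε - 4 * (x n * y n * z n)))
      (ε * (κ * (3 * Y ^ 2 * Y - 2 * Y ^ 3) - 8 * ε - 4 * 0)) :=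
    AverageTendsto.const_mul ((((((hY.const_mul (3 * Y ^ 2)).sub
      (averageTendsto_const (2 * Y ^ 3))).const_mul κ).sub
        (averageTendsto_const (8 * ε))).sub (hw.const_mul 4))) ε
  have hlim : ε * (κ * (3 * Y ^ 2 * Y - 2 * Y ^ 3) - 8 * ε - 4 * 0) = 8 * ε ^ 2 := by
    rw [hε]; ring
  rw [hlim] at hlow
  have hinv : Tendsto (fun N : ℕ => (N : ℝ)⁻¹) atTop (nhds 0) :=
    tendsto_inv_atTop_nhds_zero_nat
  have hcomb : Tendsto (fun N : ℕ => (N : ℝ)⁻¹ * ∑ k ∈ Finset.range N, f k -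
      ((N : ℝ)⁻¹ * ∑ k ∈ Finset.range N,
        (ε * (κ * (3 * Y ^ 2 * y k - 2 * Y ^ 3) - 8 * ε - 4 * (x k * y k * z k))) -
          (N : ℝ)⁻¹) / 8) atTop (nhds (0 - (8 * ε ^ 2 - 0) / 8)) :=
    Tendsto.sub hfavg ((Tendsto.sub hlow hinv).div_const 8)
  refine h.not_tendsto_x_zero (tendsto_zero_of_log_succ_le h.x_pos h.log_x_succ_le
    (δ := ε ^ 2 / 2) (by positivity) ?_)
  filter_upwards [hcomb.eventually_le_const (u := -(ε ^ 2 / 2)) (by nlinarith)] with N hN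
  refine le_trans ?_ hN
  rw [Finset.sum_sub_distrib, ← Finset.sum_div]
  have hshift : ∑ k ∈ Finset.range N, f (k + 1) ^ 2 ≤ ∑ k ∈ Finset.range N, f k ^ 2 + 1 := by
    have e₁ := Finset.sum_range_succ (fun k => f k ^ 2) N
    have e₂ := Finset.sum_range_succ' (fun k => f k ^ 2) N
    obtain ⟨e₃, e₄⟩ := h.rate_mem N
    have e₅ : f N ^ 2 ≤ 1 := by simp only [hf]; nlinarith
    linarith [sq_nonneg (f 0)]
  have htot := Finset.sum_le_sum (s := Finset.range N) fun k _ => hpt k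
  rw [Finset.sum_add_distrib] at htot
  have hN0 : (0 : ℝ) ≤ (N : ℝ)⁻¹ := by positivity
  have := mul_le_mul_of_nonneg_left (htot.trans (add_le_add_right hshift _)) hN0
  linarith

end VolterraOrbit

/-- Some symmetric starting point lies below the maximum of the Lyapunov function. -/
theorem exists_start {a b c : ℝ} (ha : 0 < a) (hb : 0 < b) (hc : 0 < c) :
    ∃ t : ℝ, 0 < t ∧ t < 1 ∧
      c * Real.log t + b * Real.log ((1 - t) / 2) + a * Real.log ((1 - t) / 2) <
        c * Real.log (c / (a + b + c)) + b * Real.log (b / (a + b + c)) +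
          a * Real.log (a / (a + b + c)) := by
  have hs : 0 < a + b + c := by positivity
  have hp : ∀ r, 0 < r → r ≤ a + b + c → r * Real.log (r / (a + b + c)) ≤ 0 := fun r hr hle =>
    mul_nonpos_of_nonneg_of_nonpos hr.le
      (Real.log_nonpos (by positivity) ((div_le_one hs).2 hle))
  have h₁ := hp a ha (by linarith)
  have h₂ := hp b hb (by linarith)
  have h₃ := hp c hc (by linarith)
  set P := c * Real.log (c / (a + b + c)) + b * Real.log (b / (a + b + c)) +
          a * Real.log (a / (a + b + c)) with hP
  have hlt : P / c - 1 < 0 := by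
    have : P / c ≤ 0 := div_nonpos_of_nonpos_of_nonneg (by linarith) hc.le
    linarith
  have ht1 := Real.exp_lt_one_iff.2 hlt
  have ht0 := Real.exp_pos (P / c - 1)
  refine ⟨Real.exp (P / c - 1), ht0, ht1, ?_⟩
  have hlog : Real.log ((1 - Real.exp (P / c - 1)) / 2) ≤ 0 :=
    Real.log_nonpos (by linarith) (by linarith)
  have hcl : c * Real.log (Real.exp (P / c - 1)) = P - c := by
    rw [Real.log_exp]; field_simp
  rw [hcl]
  nlinarith [mul_nonneg ha.le (neg_nonneg.2 hlog), mul_nonneg hb.le (neg_nonneg.2 hlog)]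

theorem volterraQSO_three_pos {a b c : ℝ} (ha : |a| ≤ 1) (hb : |b| ≤ 1) (hc : |c| ≤ 1)
    {v : Fin 3 → ℝ} (hv : ∀ i, 0 < v i) (hs : ∑ i, v i = 1) :
    (∀ i, 0 < volterraQSO !![0, a, -b; -a, 0, c; b, -c, 0] v i) ∧
      ∑ i, volterraQSO !![0, a, -b; -a, 0, c; b, -c, 0] v i = 1 := by
  have h0 := hv 0
  have h1 := hv 1
  have h2 := hv 2
  rw [Fin.sum_univ_three] at hs
  obtain ⟨ha₁, ha₂⟩ := abs_le.1 ha
  obtain ⟨hb₁, hb₂⟩ := abs_le.1 hb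
  obtain ⟨hc₁, hc₂⟩ := abs_le.1 hc
  constructor
  · intro i
    refine mul_pos (hv i) ?_
    fin_cases i <;> simp [Fin.sum_univ_three] <;> nlinarith
  · simp [volterraQSO, Fin.sum_univ_three]
    linear_combination hs

theorem iterate_volterraQSO_three_pos {a b c : ℝ} (ha : |a| ≤ 1) (hb : |b| ≤ 1) (hc : |c| ≤ 1)
    {v : Fin 3 → ℝ} (hv : ∀ i, 0 < v i) (hs : ∑ i, v i = 1) (n : ℕ) :
    (∀ i, 0 < (volterraQSO !![0, a, -b; -a, 0, c; b, -c, 0])^[n] v i) ∧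
      ∑ i, (volterraQSO !![0, a, -b; -a, 0, c; b, -c, 0])^[n] v i = 1 := by
  induction n with
  | zero => exact ⟨hv, hs⟩
  | succ n ih =>
    rw [Function.iterate_succ_apply']
    exact volterraQSO_three_pos ha hb hc ih.1 ih.2

theorem CesaroConverges.exists_averageTendsto {m : ℕ} {V : (Fin m → ℝ) → (Fin m → ℝ)}
    {v : Fin m → ℝ} (h : CesaroConverges V v) :
    ∃ L : Fin m → ℝ, ∀ i, AverageTendsto (fun n => V^[n] v i) (L i) := by
  obtain ⟨L, hL⟩ := h
  refine ⟨L, fun i => ((tendsto_pi_nhds.1 hL) i).congr fun N => ?_⟩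
  simp

/-- for nonzero `a, b, c ∈ [−1,1]` of the same sign, the ergodic theorem
fails for the Volterra QSO
`V(x₁,x₂,x₃) = (x₁(1+ax₂−bx₃), x₂(1−ax₁+cx₃), x₃(1+bx₁−cx₂))` on the simplex `S²`:
some point of `S²` has divergent Cesàro averages. -/
theorem zakharevich_nonergodic
    (a b c : ℝ) (ha : |a| ≤ 1) (hb : |b| ≤ 1) (hc : |c| ≤ 1)
    (hsign : (0 < a ∧ 0 < b ∧ 0 < c) ∨ (a < 0 ∧ b < 0 ∧ c < 0)) :
    ∃ x : Fin 3 → ℝ, (∀ i, 0 ≤ x i) ∧ (∑ i, x i = 1) ∧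
      ¬ CesaroConverges (volterraQSO !![0, a, -b; -a, 0, c; b, -c, 0]) x := by
  have hsum : ∀ t : ℝ, ∑ i, (![t, (1 - t) / 2, (1 - t) / 2] : Fin 3 → ℝ) i = 1 := fun t => by
    simp [Fin.sum_univ_three]; ring
  have hpos : ∀ t : ℝ, 0 < t → t < 1 →
      ∀ i, 0 < (![t, (1 - t) / 2, (1 - t) / 2] : Fin 3 → ℝ) i := fun t h₀ h₁ i => by
    fin_cases i <;> simp <;> linarith
  obtain ⟨ha₁, ha₂⟩ := abs_le.1 ha
  obtain ⟨hb₁, hb₂⟩ := abs_le.1 hb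
  obtain ⟨hc₁, hc₂⟩ := abs_le.1 hc
  rcases hsign with ⟨ha₀, hb₀, hc₀⟩ | ⟨ha₀, hb₀, hc₀⟩
  · obtain ⟨t, ht₀, ht₁, hlt⟩ := exists_start ha₀ hb₀ hc₀
    refine ⟨_, fun i => (hpos t ht₀ ht₁ i).le, hsum t, fun hconv => ?_⟩
    obtain ⟨L, hL⟩ := hconv.exists_averageTendsto
    have horb := iterate_volterraQSO_three_pos ha hb hc (hpos t ht₀ ht₁) (hsum t)
    refine VolterraOrbit.not_averageTendsto (a := a) (b := b) (c := c)
      ⟨ha₀, hb₀, hc₀, ha₂, hb₂, hc₂, fun n => (horb n).1 0, fun n => (horb n).1 1,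
        fun n => (horb n).1 2, fun n => ?_, fun n => ?_, fun n => ?_, fun n => ?_⟩
      (by simpa using hlt) (hL 0) (hL 1) (hL 2)
    · simpa [Fin.sum_univ_three] using (horb n).2
    all_goals
      simp only [Function.iterate_succ_apply']
      simp only [volterraQSO, Fin.sum_univ_three, of_apply, cons_val]
      ring
  · obtain ⟨t, ht₀, ht₁, hlt⟩ := exists_start (neg_pos.2 hb₀) (neg_pos.2 ha₀) (neg_pos.2 hc₀)
    refine ⟨_, fun i => (hpos t ht₀ ht₁ i).le, hsum t, fun hconv => ?_⟩
    obtain ⟨L, hL⟩ := hconv.exists_averageTendsto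
    have horb := iterate_volterraQSO_three_pos ha hb hc (hpos t ht₀ ht₁) (hsum t)
    refine VolterraOrbit.not_averageTendsto (a := -b) (b := -a) (c := -c)
      ⟨neg_pos.2 hb₀, neg_pos.2 ha₀, neg_pos.2 hc₀, by linarith, by linarith, by linarith,
        fun n => (horb n).1 0, fun n => (horb n).1 2,
        fun n => (horb n).1 1, fun n => ?_, fun n => ?_, fun n => ?_, fun n => ?_⟩
      (by simpa using hlt) (hL 0) (hL 2) (hL 1)
    · have := (horb n).2
      rw [Fin.sum_univ_three] at this
      linarith
    all_goals
      simp only [Function.iterate_succ_apply']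
      simp only [volterraQSO, Fin.sum_univ_three, of_apply, cons_val]
      ring
end

section
/- Let a be a real number with 0 < |a| < 1 and let V : S^3 → S^3 be the Volterra quadratic stochastic operator given by (V x)_1 = x_1(1 + a x_2 + a x_3 − a x_4), (V x)_2 = x_2(1 − a x_1 + a x_3 + a x_4), (V x)_3 = x_3(1 − a x_1 − a x_2 + a x_4), (V x)_4 = x_4(1 + a x_1 − a x_2 − a x_3), i.e. the Volterra QSO associated with the skew-symmetric matrix a·[[0,1,1,−1],[−1,0,1,1],[−1,−1,0,1],[1,−1,−1,0]]. Then V is not ergodic: there exists x ∈ S^3 for which the Cesàro averages (1/n) Σ_{k=0}^{n−1} V^k(x) do not converge. -/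
open Matrix Filter

open Topology

theorem Real.log_one_add_le_sub_sq_div_six {s : ℝ} (h₁ : -1 < s) (h₂ : s ≤ 1) :
    Real.log (1 + s) ≤ s - s ^ 2 / 6 := by
  have hs : 0 < 1 + s := by linarith
  have hsqrt : √(1 + s) ≤ 1 + s / 2 - s ^ 2 / 12 := by
    rw [Real.sqrt_le_left (by nlinarith)]
    nlinarith [mul_nonneg (sq_nonneg s) (sub_nonneg.2 h₂), sq_nonneg (s ^ 2)]
  have hlog := Real.log_le_sub_one_of_pos (Real.sqrt_pos.2 hs)
  rw [Real.log_sqrt hs.le] at hlog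
  linarith

/-- `(x, y, z)` is an orbit, in the interior of the triangle `S²`, of the Volterra operator in which
`x` gains from `y`, `y` gains from `z` and `z` gains from `x`, each at rate `a`. -/
structure IsCyclicOrbit (a : ℝ) (x y z : ℕ → ℝ) : Prop where
  rate_pos : 0 < a
  rate_lt_one : a < 1
  pos_fst : ∀ n, 0 < x n
  pos_snd : ∀ n, 0 < y n
  pos_thd : ∀ n, 0 < z n
  sum_eq_one : ∀ n, x n + y n + z n = 1
  step_fst : ∀ n, x (n + 1) = x n * (1 + a * (y n - z n))
  step_snd : ∀ n, y (n + 1) = y n * (1 + a * (z n - x n))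
  step_thd : ∀ n, z (n + 1) = z n * (1 + a * (x n - y n))

namespace IsCyclicOrbit

variable {a : ℝ} {x y z : ℕ → ℝ}

theorem rotate (h : IsCyclicOrbit a x y z) : IsCyclicOrbit a y z x where
  rate_pos := h.rate_pos
  rate_lt_one := h.rate_lt_one
  pos_fst := h.pos_snd
  pos_snd := h.pos_thd
  pos_thd := h.pos_fst
  sum_eq_one n := by linarith [h.sum_eq_one n]
  step_fst := h.step_snd
  step_snd := h.step_thd
  step_thd := h.step_fst

theorem of_step (ha0 : 0 < a) (ha1 : a < 1) (hx : 0 < x 0) (hy : 0 < y 0) (hz : 0 < z 0)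
    (hsum : x 0 + y 0 + z 0 = 1)
    (hxs : ∀ n, x (n + 1) = x n * (1 + a * (y n - z n)))
    (hys : ∀ n, y (n + 1) = y n * (1 + a * (z n - x n)))
    (hzs : ∀ n, z (n + 1) = z n * (1 + a * (x n - y n))) : IsCyclicOrbit a x y z := by
  have key : ∀ n, 0 < x n ∧ 0 < y n ∧ 0 < z n ∧ x n + y n + z n = 1 := by
    intro n
    induction n with
    | zero => exact ⟨hx, hy, hz, hsum⟩
    | succ n ih =>
      obtain ⟨h1, h2, h3, h4⟩ := ih
      rw [hxs, hys, hzs]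
      refine ⟨mul_pos h1 ?_, mul_pos h2 ?_, mul_pos h3 ?_, by linear_combination h4⟩ <;>
        nlinarith
  exact ⟨ha0, ha1, fun n => (key n).1, fun n => (key n).2.1, fun n => (key n).2.2.1,
    fun n => (key n).2.2.2, hxs, hys, hzs⟩

theorem prod_le (h : IsCyclicOrbit a x y z) (n : ℕ) :
    x n * y n * z n ≤ x 0 * y 0 * z 0 := by
  induction n with
  | zero => exact le_rfl
  | succ n ih =>
    refine le_trans ?_ ih
    have hx := h.pos_fst n
    have hy := h.pos_snd n
    have hz := h.pos_thd n
    have hs := h.sum_eq_one n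
    have ha0 := h.rate_pos
    have ha1 := h.rate_lt_one
    have amgm : ∀ p q r : ℝ, 0 ≤ p → 0 ≤ q → 0 ≤ r → p + q + r = 3 → p * q * r ≤ 1 := by
      intro p q r hp hq hr hpqr
      obtain rfl : r = 3 - p - q := by linarith
      nlinarith [mul_nonneg hp (sq_nonneg (q - 1)), mul_nonneg hq (sq_nonneg (p - 1)),
        mul_nonneg hr (sq_nonneg (p - q)), sq_nonneg (p - q), sq_nonneg (p + q - 2),
        mul_nonneg hr (sq_nonneg (p + q - 2)),
        mul_nonneg (add_nonneg hp hq) (sq_nonneg (p + q - 2))]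
    have hfac := amgm (1 + a * (y n - z n)) (1 + a * (z n - x n)) (1 + a * (x n - y n))
      (by nlinarith) (by nlinarith) (by nlinarith) (by ring)
    rw [h.step_fst, h.step_snd, h.step_thd]
    nlinarith [mul_pos (mul_pos hx hy) hz]

theorem sq_sub_sum_ge (h : IsCyclicOrbit a x y z) (n : ℕ) :
    (1 - 27 * (x 0 * y 0 * z 0)) / 2 ≤
      (x n - y n) ^ 2 + (y n - z n) ^ 2 + (z n - x n) ^ 2 := by
  have schur : ∀ p q r : ℝ, 0 ≤ p → 0 ≤ q → 0 ≤ r → p + q + r = 1 →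
      (1 - 27 * (p * q * r)) / 2 ≤ (p - q) ^ 2 + (q - r) ^ 2 + (r - p) ^ 2 := by
    intro p q r hp hq hr hs
    have hS : 0 ≤ p * (p - q) * (p - r) + q * (q - p) * (q - r) + r * (r - p) * (r - q) := by
      rcases le_total p q with h1 | h1 <;> rcases le_total q r with h2 | h2 <;>
        rcases le_total p r with h3 | h3 <;>
        nlinarith [mul_nonneg (sub_nonneg.2 h1) (sub_nonneg.2 h2),
          mul_nonneg (sub_nonneg.2 h1) (sub_nonneg.2 h3),
          mul_nonneg (sub_nonneg.2 h2) (sub_nonneg.2 h3),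
          mul_nonneg hp (mul_nonneg (sub_nonneg.2 h1) (sub_nonneg.2 h3)),
          mul_nonneg hq (mul_nonneg (sub_nonneg.2 h1) (sub_nonneg.2 h2)),
          mul_nonneg hr (mul_nonneg (sub_nonneg.2 h2) (sub_nonneg.2 h3)),
          mul_nonneg (sub_nonneg.2 h1) (sq_nonneg (p - q)),
          mul_nonneg (add_nonneg hp hq) (sq_nonneg (p - q)),
          mul_nonneg (add_nonneg hr hq) (sq_nonneg (r - q)),
          mul_nonneg (add_nonneg hp hr) (sq_nonneg (p - r)),
          mul_nonneg hp (sq_nonneg (p - q)), mul_nonneg hp (sq_nonneg (p - r)),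
          mul_nonneg hq (sq_nonneg (q - p)), mul_nonneg hq (sq_nonneg (q - r)),
          mul_nonneg hr (sq_nonneg (r - q)), mul_nonneg hr (sq_nonneg (r - p))]
    obtain rfl : r = 1 - p - q := by linarith
    linarith
  have := schur _ _ _ (h.pos_fst n).le (h.pos_snd n).le (h.pos_thd n).le (h.sum_eq_one n)
  linarith [h.prod_le n]

theorem not_tendsto_zero (h : IsCyclicOrbit a x y z) : ¬ Tendsto x atTop (𝓝 0) := by
  intro hx
  have ha0 := h.rate_pos
  have ha1 := h.rate_lt_one
  obtain ⟨N, hN⟩ := eventually_atTop.1 (hx.eventually_lt_const (by norm_num : (0 : ℝ) < 1 / 6))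
  have hratio : ∀ k, z (N + k) ≤ (1 - a / 4) ^ k * (z N / y N) * y (N + k) := by
    intro k
    induction k with
    | zero => simp [(h.pos_snd N).ne']
    | succ k ih =>
      have hxk := hN (N + k) (by omega)
      have hpx := h.pos_fst (N + k)
      have hpy := h.pos_snd (N + k)
      have hpz := h.pos_thd (N + k)
      have hs := h.sum_eq_one (N + k)
      have hpos : 0 ≤ 1 + a * (x (N + k) - y (N + k)) := by nlinarith
      have hle : 1 + a * (x (N + k) - y (N + k)) ≤
          (1 - a / 4) * (1 + a * (z (N + k) - x (N + k))) := by
        have h2 : a * (z (N + k) - x (N + k)) ≤ 1 := by nlinarith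
        nlinarith
      have hc : 0 ≤ (1 - a / 4) ^ k * (z N / y N) * y (N + k) := hpz.le.trans ih
      rw [← add_assoc, h.step_thd, h.step_snd]
      calc z (N + k) * (1 + a * (x (N + k) - y (N + k)))
          ≤ ((1 - a / 4) ^ k * (z N / y N) * y (N + k)) *
            ((1 - a / 4) * (1 + a * (z (N + k) - x (N + k)))) := by gcongr
        _ = _ := by ring
  have hgeom : Tendsto (fun k : ℕ => (1 - a / 4) ^ k * (z N / y N)) atTop (𝓝 0) := by
    simpa using (tendsto_pow_atTop_nhds_zero_of_lt_one (r := 1 - a / 4)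
      (by linarith) (by linarith)).mul_const (z N / y N)
  obtain ⟨K, hK⟩ := eventually_atTop.1 (hgeom.eventually_lt_const one_pos)
  have hmono : ∀ k, x (N + K) ≤ x (N + K + k) := by
    intro k
    induction k with
    | zero => exact le_rfl
    | succ k ih =>
      refine ih.trans ?_
      have h1 := hratio (K + k)
      have h2 := hK (K + k) (by omega)
      rw [← add_assoc] at h1
      have hpy := h.pos_snd (N + K + k)
      have hzy : z (N + K + k) ≤ y (N + K + k) := by nlinarith
      rw [← add_assoc, h.step_fst]
      have := mul_nonneg (h.pos_fst (N + K + k)).le (mul_nonneg ha0.le (sub_nonneg.2 hzy))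
      linarith
  obtain ⟨M, hM⟩ := eventually_atTop.1 (hx.eventually_lt_const (h.pos_fst (N + K)))
  have h1 := hM (N + K + M) (by omega)
  linarith [hmono M]

theorem log_le (h : IsCyclicOrbit a x y z) {δ : ℝ}
    (hδ : ∀ n, δ ≤ (x n - y n) ^ 2 + (y n - z n) ^ 2 + (z n - x n) ^ 2) (n : ℕ) :
    Real.log (x n) ≤ Real.log (x 0) +
      a * (∑ k ∈ Finset.range n, y k - ∑ k ∈ Finset.range n, z k) -
      a ^ 2 / 18 * (n * δ + ∑ k ∈ Finset.range n, y k + ∑ k ∈ Finset.range n, z k -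
        2 * ∑ k ∈ Finset.range n, x k) +
      a / 6 * ((y n - z n) - (y 0 - z 0)) := by
  induction n with
  | zero => simp
  | succ n ih =>
    have ha0 := h.rate_pos
    have ha1 := h.rate_lt_one
    have hx := h.pos_fst n
    have hy := h.pos_snd n
    have hz := h.pos_thd n
    have hs := h.sum_eq_one n
    have hpos : 0 < 1 + a * (y n - z n) := by nlinarith
    have hlog := Real.log_one_add_le_sub_sq_div_six (s := a * (y n - z n))
      (by linarith) (by nlinarith)
    have hsq : 3 * (y n - z n) ^ 2 = (x n - y n) ^ 2 + (y n - z n) ^ 2 + (z n - x n) ^ 2 +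
        (y n + z n - 2 * x n) + 3 * y n * (x n - z n) + 3 * z n * (x n - y n) := by
      obtain hxe : x n = 1 - y n - z n := by linarith
      rw [hxe]
      ring
    have hδn := mul_le_mul_of_nonneg_left (hδ n) (sq_nonneg a)
    rw [h.step_fst, Real.log_mul hx.ne' hpos.ne', h.step_snd, h.step_thd]
    simp only [Finset.sum_range_succ, Nat.cast_add, Nat.cast_one]
    linear_combination ih + hlog + hδn / 18 - a ^ 2 / 18 * hsq

theorem le_of_tendsto_average (h : IsCyclicOrbit a x y z) {δ p q r : ℝ}
    (hδ : ∀ n, δ ≤ (x n - y n) ^ 2 + (y n - z n) ^ 2 + (z n - x n) ^ 2)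
    (hp : Tendsto (fun n : ℕ => (n : ℝ)⁻¹ * ∑ k ∈ Finset.range n, x k) atTop (𝓝 p))
    (hq : Tendsto (fun n : ℕ => (n : ℝ)⁻¹ * ∑ k ∈ Finset.range n, y k) atTop (𝓝 q))
    (hr : Tendsto (fun n : ℕ => (n : ℝ)⁻¹ * ∑ k ∈ Finset.range n, z k) atTop (𝓝 r)) :
    a ^ 2 / 18 * (δ + q + r - 2 * p) ≤ a * (q - r) := by
  by_contra! hlt
  have ha0 := h.rate_pos
  refine h.not_tendsto_zero ?_
  have hn : Tendsto (fun n : ℕ => (n : ℝ)) atTop atTop := tendsto_natCast_atTop_atTop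
  set g : ℕ → ℝ := fun n =>
    a * ((n : ℝ)⁻¹ * ∑ k ∈ Finset.range n, y k - (n : ℝ)⁻¹ * ∑ k ∈ Finset.range n, z k) -
      a ^ 2 / 18 * (δ + (n : ℝ)⁻¹ * ∑ k ∈ Finset.range n, y k +
        (n : ℝ)⁻¹ * ∑ k ∈ Finset.range n, z k -
        2 * ((n : ℝ)⁻¹ * ∑ k ∈ Finset.range n, x k)) with hg
  have hglim : Tendsto g atTop (𝓝 (a * (q - r) - a ^ 2 / 18 * (δ + q + r - 2 * p))) :=
    ((hq.sub hr).const_mul a).sub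
      ((((hq.const_add δ).add hr).sub (hp.const_mul 2)).const_mul (a ^ 2 / 18))
  have hbot : Tendsto (fun n : ℕ => (n : ℝ) * g n + (Real.log (x 0) + a / 3)) atTop atBot :=
    tendsto_atBot_add_const_right _ _ (hn.atTop_mul_neg (by linarith) hglim)
  have hlog : Tendsto (fun n => Real.log (x n)) atTop atBot := by
    refine tendsto_atBot_mono' _ ?_ hbot
    filter_upwards [eventually_gt_atTop 0] with n hn0
    have hn1 : (n : ℝ) ≠ 0 := by positivity
    have hgn : (n : ℝ) * g n =
        a * (∑ k ∈ Finset.range n, y k - ∑ k ∈ Finset.range n, z k) -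
        a ^ 2 / 18 * (n * δ + ∑ k ∈ Finset.range n, y k + ∑ k ∈ Finset.range n, z k -
          2 * ∑ k ∈ Finset.range n, x k) := by
      simp only [hg]
      field_simp
    have hbd : (y n - z n) - (y 0 - z 0) ≤ 2 := by
      linarith [h.pos_fst n, h.pos_thd n, h.sum_eq_one n, h.pos_fst 0, h.pos_snd 0,
        h.sum_eq_one 0]
    rw [hgn]
    linarith [h.log_le hδ n, mul_le_mul_of_nonneg_left hbd ha0.le]
  exact (Real.tendsto_exp_atBot.comp hlog).congr fun n => Real.exp_log (h.pos_fst n)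

theorem not_tendsto_average (h : IsCyclicOrbit a x y z) (h0 : x 0 * y 0 * z 0 < 1 / 27)
    {p q r : ℝ}
    (hp : Tendsto (fun n : ℕ => (n : ℝ)⁻¹ * ∑ k ∈ Finset.range n, x k) atTop (𝓝 p))
    (hq : Tendsto (fun n : ℕ => (n : ℝ)⁻¹ * ∑ k ∈ Finset.range n, y k) atTop (𝓝 q))
    (hr : Tendsto (fun n : ℕ => (n : ℝ)⁻¹ * ∑ k ∈ Finset.range n, z k) atTop (𝓝 r)) :
    False := by
  have hδ := h.sq_sub_sum_ge
  have h1 := h.le_of_tendsto_average hδ hp hq hr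
  have h2 := h.rotate.le_of_tendsto_average (fun n => (hδ n).trans_eq (by ring)) hq hr hp
  have h3 := h.rotate.rotate.le_of_tendsto_average (fun n => (hδ n).trans_eq (by ring)) hr hp hq
  have ha := h.rate_pos
  have : 0 < a ^ 2 * ((1 - 27 * (x 0 * y 0 * z 0)) / 2) :=
    mul_pos (by positivity) (by linarith)
  linarith

end IsCyclicOrbit

/-- for `0 < |a| < 1`, the Volterra QSO on `S³` associated with the
skew-symmetric matrix `a • [[0,1,1,−1],[−1,0,1,1],[−1,−1,0,1],[1,−1,−1,0]]` is not
ergodic: some point of the simplex `S³` has divergent Cesàro averages. -/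
theorem four_dim_volterra_qso_nonergodic
    (a : ℝ) (ha0 : 0 < |a|) (ha1 : |a| < 1) :
    ∃ x : Fin 4 → ℝ, (∀ i, 0 ≤ x i) ∧ (∑ i, x i = 1) ∧
      ¬ CesaroConverges
          (volterraQSO (a • !![0, 1, 1, -1; -1, 0, 1, 1; -1, -1, 0, 1; 1, -1, -1, 0])) x := by
  refine ⟨![1 / 2, 1 / 4, 0, 1 / 4], ?_, ?_, ?_⟩
  · intro i
    fin_cases i <;> norm_num
  · simp [Fin.sum_univ_four]
    norm_num
  rintro ⟨L, hL⟩
  set V := volterraQSO (a • !![0, 1, 1, -1; -1, 0, 1, 1; -1, -1, 0, 1; 1, -1, -1, 0]) with hV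
  set u : ℕ → Fin 4 → ℝ := fun n => V^[n] ![1 / 2, 1 / 4, 0, 1 / 4] with hu
  have hu0 : u 0 0 = 1 / 2 := rfl
  have hu1 : u 0 1 = 1 / 4 := rfl
  have hu2 : u 0 2 = 0 := rfl
  have hu3 : u 0 3 = 1 / 4 := rfl
  have hstep : ∀ n k, u (n + 1) k = V (u n) k := fun n k => by
    simp only [hu, Function.iterate_succ_apply']
  have hzero : ∀ n, u n 2 = 0 := by
    intro n
    induction n with
    | zero => exact hu2
    | succ n ih => simp [hstep, hV, volterraQSO, ih]
  have h0 : ∀ n, u (n + 1) 0 = u n 0 * (1 + a * (u n 1 - u n 3)) := by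
    intro n
    simp [hstep, hV, volterraQSO, Fin.sum_univ_four, hzero n, -mul_eq_mul_left_iff]
    ring
  have h1 : ∀ n, u (n + 1) 1 = u n 1 * (1 + a * (u n 3 - u n 0)) := by
    intro n
    simp [hstep, hV, volterraQSO, Fin.sum_univ_four, hzero n, -mul_eq_mul_left_iff]
    ring
  have h3 : ∀ n, u (n + 1) 3 = u n 3 * (1 + a * (u n 0 - u n 1)) := by
    intro n
    simp [hstep, hV, volterraQSO, Fin.sum_univ_four, hzero n, -mul_eq_mul_left_iff]
    ring
  have hlim : ∀ i, Tendsto (fun n : ℕ => (n : ℝ)⁻¹ * ∑ k ∈ Finset.range n, u k i) atTop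
      (𝓝 (L i)) := by
    intro i
    simpa [Finset.sum_apply] using (tendsto_pi_nhds.1 hL) i
  rcases lt_or_gt_of_ne (abs_pos.1 ha0) with ha | ha
  · rw [abs_of_neg ha] at ha1
    have horb : IsCyclicOrbit (-a) (fun n => u n 0) (fun n => u n 3) (fun n => u n 1) := by
      refine .of_step (by linarith) ha1 ?_ ?_ ?_ ?_ (fun n => ?_) (fun n => ?_) (fun n => ?_)
      · norm_num [hu0, hu1, hu3]
      · norm_num [hu0, hu1, hu3]
      · norm_num [hu0, hu1, hu3]
      · norm_num [hu0, hu1, hu3]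
      · rw [h0]; ring
      · rw [h3]; ring
      · rw [h1]; ring
    exact horb.not_tendsto_average (by norm_num [hu0, hu1, hu3]) (hlim 0) (hlim 3) (hlim 1)
  · rw [abs_of_pos ha] at ha1
    have horb : IsCyclicOrbit a (fun n => u n 0) (fun n => u n 1) (fun n => u n 3) := by
      refine .of_step ha ha1 ?_ ?_ ?_ ?_ h0 h1 h3 <;> norm_num [hu0, hu1, hu3]
    exact horb.not_tendsto_average (by norm_num [hu0, hu1, hu3]) (hlim 0) (hlim 1) (hlim 3)
end

section
/- Let E be a finite-dimensional evolution algebra over a field K with natural basis {e_1, …, e_n} and structural matrix A. Then the subspace E·E (the linear span of all products xy with x, y ∈ E) has dimension equal to the rank of A; in particular, the rank of the structural matrix does not depend on the choice of natural basis. -/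
open Matrix

theorem evolMul_eq_sum_smul_row {K : Type} [Field K] {n : ℕ} (A : Matrix (Fin n) (Fin n) K)
    (x y : Fin n → K) : evolMul A x y = ∑ i, (x i * y i) • A.row i := by
  ext k
  simp [evolMul, Finset.sum_apply]

theorem evolMul_single_self {K : Type} [Field K] {n : ℕ} (A : Matrix (Fin n) (Fin n) K)
    (i : Fin n) : evolMul A (Pi.single i 1) (Pi.single i 1) = A.row i := by
  ext k
  simp [evolMul, Pi.single_apply]

theorem span_evolMul_eq_span_row {K : Type} [Field K] {n : ℕ} (A : Matrix (Fin n) (Fin n) K) :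
    Submodule.span K {z : Fin n → K | ∃ x y : Fin n → K, z = evolMul A x y} =
      Submodule.span K (Set.range A.row) := by
  apply le_antisymm <;> rw [Submodule.span_le]
  · rintro _ ⟨x, y, rfl⟩
    rw [evolMul_eq_sum_smul_row]
    exact Submodule.sum_mem _ fun i _ =>
      Submodule.smul_mem _ _ (Submodule.subset_span ⟨i, rfl⟩)
  · rintro _ ⟨i, rfl⟩
    exact Submodule.subset_span ⟨_, _, (evolMul_single_self A i).symm⟩

/-- for a finite-dimensional evolution algebra `E` with structural matrix
`A`, the subspace `E·E` (the span of all products) has dimension equal to the rank of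
`A`; in particular the rank of the structural matrix does not depend on the choice of
natural basis. -/
theorem dim_square_eq_rank
    {K : Type} [Field K] {n : ℕ} (A : Matrix (Fin n) (Fin n) K) :
    Module.finrank K
        ↥(Submodule.span K {z : Fin n → K | ∃ x y : Fin n → K, z = evolMul A x y}) =
      A.rank := by
  rw [span_evolMul_eq_span_row, A.rank_eq_finrank_span_row]
end

section
/- Let K be a field of characteristic zero and let E be the 3-dimensional Volterra evolution algebra over K with natural basis {e_1, e_2, e_3} and structural matrix [[0, 1, 0], [−1, 0, 0], [0, 0, 0]] (so e_1² = e_2, e_2² = −e_1, e_3² = 0). Then the derivations of E are exactly the linear maps D with D(e_1) = 0, D(e_2) = 0, D(e_3) = α e_3 for some α ∈ K; moreover ann(E) = span{e_3} is one-dimensional. -/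
open Matrix

/-- The product of the degenerate three-dimensional Volterra algebra in coordinates. -/
theorem evolMul_degenerate_volterra {K : Type} [Field K] (x y : Fin 3 → K) :
    evolMul !![(0:K), 1, 0; -1, 0, 0; 0, 0, 0] x y = ![-(x 1 * y 1), x 0 * y 0, 0] := by
  ext k
  fin_cases k <;> simp [evolMul, Fin.sum_univ_three]

/-- A linear map on `K³` in terms of the images of the coordinate vectors. -/
theorem LinearMap.apply_eq_of_fin_three {K : Type} [Field K]
    (D : (Fin 3 → K) →ₗ[K] (Fin 3 → K)) (x : Fin 3 → K) :
    D x = x 0 • D (Pi.single 0 1) + x 1 • D (Pi.single 1 1) + x 2 • D (Pi.single 2 1) := by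
  rw [D.pi_apply_eq_sum_univ x, Fin.sum_univ_three]
  congr! <;> simp [Pi.single_apply, eq_comm]

/-- for the 3-dimensional Volterra evolution algebra over a field `K` of
characteristic zero with structural matrix `[[0,1,0],[−1,0,0],[0,0,0]]`
(`e₁² = e₂`, `e₂² = −e₁`, `e₃² = 0`), the derivations are exactly the linear maps `D`
with `D e₁ = 0`, `D e₂ = 0`, `D e₃ = α e₃` for some `α ∈ K`; moreover the annihilator
`ann(E)` is the span of `e₃`, which is one-dimensional. -/
theorem derivations_of_degenerate_three_dim_volterra
    {K : Type} [Field K] [CharZero K] :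
    (∀ D : (Fin 3 → K) →ₗ[K] (Fin 3 → K),
      (∀ x y : Fin 3 → K,
          D (evolMul !![(0:K), 1, 0; -1, 0, 0; 0, 0, 0] x y) =
            evolMul !![(0:K), 1, 0; -1, 0, 0; 0, 0, 0] (D x) y +
              evolMul !![(0:K), 1, 0; -1, 0, 0; 0, 0, 0] x (D y)) ↔
      (∃ α : K, D (Pi.single 0 1) = 0 ∧ D (Pi.single 1 1) = 0 ∧
          D (Pi.single 2 1) = α • (Pi.single 2 1 : Fin 3 → K))) ∧
    {x : Fin 3 → K | ∀ y : Fin 3 → K,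
        evolMul !![(0:K), 1, 0; -1, 0, 0; 0, 0, 0] x y = 0 ∧
        evolMul !![(0:K), 1, 0; -1, 0, 0; 0, 0, 0] y x = 0} =
      ↑(Submodule.span K {(Pi.single 2 1 : Fin 3 → K)}) ∧
    Module.finrank K ↥(Submodule.span K {(Pi.single 2 1 : Fin 3 → K)}) = 1 := by
  simp only [evolMul_degenerate_volterra]
  refine ⟨fun D => ⟨fun h => ?_, ?_⟩, ?_, finrank_span_singleton (by simp)⟩
  · have h₀ := h (Pi.single 0 1) (Pi.single 0 1)
    have h₁ := h (Pi.single 1 1) (Pi.single 1 1)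
    have h₀₂ := h (Pi.single 0 1) (Pi.single 2 1)
    have h₁₂ := h (Pi.single 1 1) (Pi.single 2 1)
    rw [D.apply_eq_of_fin_three ![_, _, _]] at h₀ h₁ h₀₂ h₁₂
    simp only [funext_iff, Fin.forall_fin_succ] at h₀ h₁ h₀₂ h₁₂
    simp at h₀ h₁ h₀₂ h₁₂
    have ha : D (Pi.single 0 1) 0 = 0 := by
      have h₃ : (3 : K) * D (Pi.single 0 1) 0 = 0 := by
        linear_combination h₁.1 - 2 * h₀.2.1
      simpa using h₃
    refine ⟨D (Pi.single 2 1) 2, ?_, ?_, ?_⟩ <;> ext k <;> fin_cases k <;> simp <;> grind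
  · rintro ⟨α, h₀, h₁, h₂⟩ x y
    rw [D.apply_eq_of_fin_three ![_, _, _], D.apply_eq_of_fin_three x,
      D.apply_eq_of_fin_three y, h₀, h₁, h₂]
    ext k
    fin_cases k <;> simp
  · ext x
    simp only [Set.mem_ofPred_eq, SetLike.mem_coe, Submodule.mem_span_singleton]
    constructor
    · intro h
      have h₀ := congrFun (h (Pi.single 0 1)).1 1
      have h₁ := congrFun (h (Pi.single 1 1)).1 0
      simp at h₀ h₁
      refine ⟨x 2, ?_⟩
      ext k
      fin_cases k <;> simp [h₀, h₁]
    · rintro ⟨a, rfl⟩ y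
      simp
end
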